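/- arXiv:math/9604236 — 9 statements merged into one kernel-verified Lean document; each statement's English description precedes it below -/
import Mathlib

section
/- Almost every point of the entry set has finite forward exit time: μ({a ∈ I : t⁺(a) = ∞}) = 0. -/
open MeasureTheory

/-- Forward exit time from `A` under `f`: the least `n ≥ 1` with `f^[n] a ∉ A`
(`⊤` if no such `n` exists). For the backward exit time, apply this to the
inverse map `g` of `f`. -/
noncomputable def exitTime {M : Type*} (f : M → M) (A : Set M) (a : M) : ℕ∞ :=
  sInf ((fun n : ℕ => (n : ℕ∞)) '' {n : ℕ | 1 ≤ n ∧ f^[n] a ∉ A})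

/-- The entry set `I = A \ f(A)`. -/
def entrySet {M : Type*} (f : M → M) (A : Set M) : Set M := A \ f '' A

/-- The transit-time component `T_j`: points of the entry set with exit time `j`. -/
noncomputable def transitComp {M : Type*} (f : M → M) (A : Set M) (j : ℕ) : Set M :=
  {a ∈ entrySet f A | exitTime f A a = (j : ℕ∞)}

/-- The transit time `t_transit = t⁺ + t⁻ - 1`, where `g` is the inverse of `f`. -/
noncomputable def transitTime {M : Type*} (f g : M → M) (A : Set M) (a : M) : ℕ∞ :=
  exitTime f A a + exitTime g A a - 1

/-- The accessible set: points of `A` with finite backward exit time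
(`g` is the inverse of `f`). -/
noncomputable def accSet {M : Type*} (g : M → M) (A : Set M) : Set M :=
  {a ∈ A | exitTime g A a ≠ ⊤}

/-- Almost every point of the entry set has finite forward exit time. -/
theorem entry_ae_finite_exit {M : Type*} [MeasurableSpace M] (μ : Measure M)
    (f g : M → M) (hgf : Function.LeftInverse g f) (hfg : Function.RightInverse g f)
    (hf : MeasurePreserving f μ μ) (hg : MeasurePreserving g μ μ)
    (A : Set M) (hA : MeasurableSet A) (hAfin : μ A ≠ ⊤) :
    μ {a ∈ entrySet f A | exitTime f A a = ⊤} = 0 := by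
  have hBm : MeasurableSet (⋂ n : ℕ, f^[n] ⁻¹' A) :=
    MeasurableSet.iInter fun n => (hf.measurable.iterate n) hA
  set B : Set M := ⋂ n : ℕ, f^[n] ⁻¹' A with hB
  have hBA : B ⊆ A := fun x hx => by
    have := Set.mem_iInter.1 hx 0
    simpa using this
  have hsub : g ⁻¹' B ⊆ B := by
    intro x hx
    refine Set.mem_iInter.2 fun n => ?_
    have := Set.mem_iInter.1 hx (n + 1)
    simpa [Function.iterate_succ_apply, hfg x] using this
  have hm : μ (g ⁻¹' B) = μ B := hg.measure_preimage hBm.nullMeasurableSet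
  have hfin : μ (g ⁻¹' B) ≠ ⊤ := by
    rw [hm]
    exact ne_top_of_le_ne_top hAfin (measure_mono hBA)
  have hz : μ (B \ g ⁻¹' B) = 0 := by
    rw [measure_diff hsub (hg.measurable hBm).nullMeasurableSet hfin, hm, tsub_self]
  refine measure_mono_null ?_ hz
  rintro a ⟨⟨haA, haf⟩, hat⟩
  refine ⟨Set.mem_iInter.2 fun n => ?_, fun h => haf ⟨g a, hBA h, hfg a⟩⟩
  rcases Nat.eq_zero_or_pos n with rfl | hn
  · simpa using haA
  · by_contra hc
    have h1 : exitTime f A a ≤ (n : ℕ∞) := sInf_le ⟨n, ⟨hn, hc⟩, rfl⟩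
    rw [hat] at h1
    exact ENat.coe_ne_top n (top_le_iff.1 h1)
end

section
/- The sets T_j^i := f^i(T_j), for j ≥ 1 and 0 ≤ i ≤ j − 1, are pairwise disjoint subsets of A; specifically, every point of f^i(T_j) lies in A, has transit time j, and has backward exit time i + 1. -/
open MeasureTheory

theorem exitTime_eq_coe_iff {M : Type*} (f : M → M) (A : Set M) (a : M) (n : ℕ) :
    exitTime f A a = (n : ℕ∞) ↔
      1 ≤ n ∧ f^[n] a ∉ A ∧ ∀ m, 1 ≤ m → m < n → f^[m] a ∈ A := by
  constructor
  · intro h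
    unfold exitTime at h
    have hne : ((fun n : ℕ => (n : ℕ∞)) '' {n : ℕ | 1 ≤ n ∧ f^[n] a ∉ A}).Nonempty := by
      by_contra hc
      rw [Set.not_nonempty_iff_eq_empty] at hc
      rw [hc, sInf_empty] at h
      exact ENat.natCast_ne_top n h.symm
    have hmem := csInf_mem hne
    rw [h] at hmem
    obtain ⟨k, ⟨hk1, hk2⟩, hk⟩ := hmem
    have hkn : k = n := Nat.cast_injective (R := ℕ∞) hk
    subst hkn
    refine ⟨hk1, hk2, fun m hm hmn => ?_⟩
    by_contra hc
    have : sInf ((fun n : ℕ => (n : ℕ∞)) '' {n : ℕ | 1 ≤ n ∧ f^[n] a ∉ A}) ≤ (m : ℕ∞) :=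
      sInf_le ⟨m, ⟨hm, hc⟩, rfl⟩
    rw [h] at this
    have : k ≤ m := by exact_mod_cast this
    omega
  · rintro ⟨h1, h2, h3⟩
    apply le_antisymm
    · exact sInf_le ⟨n, ⟨h1, h2⟩, rfl⟩
    · apply le_sInf
      rintro _ ⟨k, ⟨hk1, hk2⟩, rfl⟩
      have : n ≤ k := by
        by_contra hc
        exact hk2 (h3 k hk1 (by omega))
      exact Nat.cast_le.mpr this

/-- The sets `T_j^i = f^i(T_j)`, `j ≥ 1`, `0 ≤ i ≤ j-1`, are pairwise disjoint
subsets of `A`; each point of `f^i(T_j)` lies in `A`, has transit time `j` and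
backward exit time `i + 1`. -/
theorem image_transitComp_props {M : Type*} [MeasurableSpace M] (μ : Measure M)
    (f g : M → M) (hgf : Function.LeftInverse g f) (hfg : Function.RightInverse g f)
    (hf : MeasurePreserving f μ μ) (hg : MeasurePreserving g μ μ)
    (A : Set M) (hA : MeasurableSet A) (hAfin : μ A ≠ ⊤) :
    (∀ j i : ℕ, 1 ≤ j → i < j → ∀ a ∈ f^[i] '' transitComp f A j,
      a ∈ A ∧ transitTime f g A a = (j : ℕ∞) ∧ exitTime g A a = ((i + 1 : ℕ) : ℕ∞)) ∧
    (∀ j i j' i' : ℕ, 1 ≤ j → i < j → 1 ≤ j' → i' < j' → (j, i) ≠ (j', i') →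
      Disjoint (f^[i] '' transitComp f A j) (f^[i'] '' transitComp f A j')) := by
  have key : ∀ j i : ℕ, 1 ≤ j → i < j → ∀ a ∈ f^[i] '' transitComp f A j,
      a ∈ A ∧ transitTime f g A a = (j : ℕ∞) ∧ exitTime g A a = ((i + 1 : ℕ) : ℕ∞) := by
    rintro j i hj hij _ ⟨x, ⟨⟨hxA, hxf⟩, hx⟩, rfl⟩
    rw [exitTime_eq_coe_iff] at hx
    obtain ⟨-, hx2, hx3⟩ := hx
    have hin : ∀ m, m < j → f^[m] x ∈ A := by
      intro m hm
      rcases Nat.eq_zero_or_pos m with rfl | h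
      · exact hxA
      · exact hx3 m h hm
    have hback : ∀ m, m ≤ i → g^[m] (f^[i] x) = f^[i - m] x := by
      intro m hm
      have h1 : f^[i] x = f^[m] (f^[i - m] x) := by
        rw [← Function.iterate_add_apply]
        congr 2
        omega
      rw [h1]
      exact hgf.iterate m _
    have hgt : exitTime g A (f^[i] x) = ((i + 1 : ℕ) : ℕ∞) := by
      rw [exitTime_eq_coe_iff]
      refine ⟨by omega, ?_, ?_⟩
      · rw [Function.iterate_succ_apply', hback i le_rfl]
        simp only [Nat.sub_self, Function.iterate_zero, id]
        intro hc
        exact hxf ⟨g x, hc, hfg x⟩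
      · intro m _ hm
        rw [hback m (by omega)]
        exact hin _ (by omega)
    have hft : exitTime f A (f^[i] x) = ((j - i : ℕ) : ℕ∞) := by
      rw [exitTime_eq_coe_iff]
      refine ⟨by omega, ?_, ?_⟩
      · rw [← Function.iterate_add_apply, Nat.sub_add_cancel hij.le]
        exact hx2
      · intro m _ hm
        rw [← Function.iterate_add_apply]
        exact hin _ (by omega)
    refine ⟨hin i hij, ?_, hgt⟩
    unfold transitTime
    rw [hgt, hft]
    have : j - i + (i + 1) - 1 = j := by omega
    exact_mod_cast this
  refine ⟨key, ?_⟩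
  intro j i j' i' hj hij hj' hij' hne
  rw [Set.disjoint_left]
  intro a ha ha'
  obtain ⟨-, h1, h2⟩ := key j i hj hij a ha
  obtain ⟨-, h1', h2'⟩ := key j' i' hj' hij' a ha'
  rw [h1] at h1'
  rw [h2] at h2'
  have e1 : j = j' := by exact_mod_cast h1'
  have e2 : i + 1 = i' + 1 := by exact_mod_cast h2'
  exact hne (Prod.ext e1 (by simpa using e2))
end

section
/- Up to a set of μ-measure zero, the accessible set A_acc equals the disjoint union of the sets f^i(T_j) over all j ≥ 1 and 0 ≤ i ≤ j − 1; that is, the symmetric difference of A_acc and ⋃_{j≥1} ⋃_{i=0}^{j−1} f^i(T_j) is μ-null. -/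
open MeasureTheory

theorem exitTime_eq_top_iff' {M : Type*} (f : M → M) (A : Set M) (a : M) :
    exitTime f A a = ⊤ ↔ ∀ n, 1 ≤ n → f^[n] a ∈ A := by
  unfold exitTime
  rw [sInf_eq_top]
  constructor
  · intro h n hn
    by_contra hc
    exact ENat.coe_ne_top n (h _ ⟨n, ⟨hn, hc⟩, rfl⟩)
  · rintro h _ ⟨n, ⟨hn, hc⟩, rfl⟩
    exact absurd (h n hn) hc

theorem exitTime_spec' {M : Type*} (f : M → M) (A : Set M) (a : M) (h : exitTime f A a ≠ ⊤) :
    ∃ j : ℕ, exitTime f A a = j ∧ 1 ≤ j ∧ f^[j] a ∉ A ∧ ∀ n, 1 ≤ n → n < j → f^[n] a ∈ A := by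
  have hne : {n : ℕ | 1 ≤ n ∧ f^[n] a ∉ A}.Nonempty := by
    by_contra hc
    apply h
    rw [exitTime_eq_top_iff']
    intro n hn
    by_contra hx
    exact hc ⟨n, hn, hx⟩
  have hm := Nat.sInf_mem hne
  refine ⟨sInf {n : ℕ | 1 ≤ n ∧ f^[n] a ∉ A}, ?_, hm.1, hm.2, ?_⟩
  · unfold exitTime
    apply le_antisymm
    · exact sInf_le ⟨_, hm, rfl⟩
    · apply le_sInf
      rintro _ ⟨n, hn, rfl⟩
      exact Nat.cast_le.2 (Nat.sInf_le hn)
  · intro n hn hlt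
    by_contra hx
    exact Nat.notMem_of_lt_sInf hlt ⟨hn, hx⟩

/-- Up to a μ-null set, the accessible set is the union of the sets `f^i(T_j)`
over `j ≥ 1`, `0 ≤ i ≤ j - 1`. -/
theorem accSet_ae_eq_union {M : Type*} [MeasurableSpace M] (μ : Measure M)
    (f g : M → M) (hgf : Function.LeftInverse g f) (hfg : Function.RightInverse g f)
    (hf : MeasurePreserving f μ μ) (hg : MeasurePreserving g μ μ)
    (A : Set M) (hA : MeasurableSet A) (hAfin : μ A ≠ ⊤) :
    μ (symmDiff (accSet g A)
        (⋃ j : ℕ, ⋃ (_ : 1 ≤ j), ⋃ i : ℕ, ⋃ (_ : i < j), f^[i] '' transitComp f A j)) = 0 := by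
  have hfg' : ∀ x, f (g x) = x := hfg
  have hgf' : ∀ x, g (f x) = x := hgf
  have key1 : ∀ n k x, g^[n] (f^[n + k] x) = f^[k] x := by
    intro n k x
    rw [Function.iterate_add_apply]
    exact hgf.iterate n _
  have key2 : ∀ n k x, f^[n] (g^[n + k] x) = g^[k] x := by
    intro n k x
    rw [Function.iterate_add_apply]
    exact Function.LeftInverse.iterate hfg n _
  have hent : ∀ z, z ∈ entrySet f A ↔ z ∈ A ∧ g z ∉ A := by
    intro z
    unfold entrySet
    constructor
    · rintro ⟨h1, h2⟩
      exact ⟨h1, fun h => h2 ⟨g z, h, hfg' z⟩⟩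
    · rintro ⟨h1, h2⟩
      refine ⟨h1, ?_⟩
      rintro ⟨y, hy, rfl⟩
      rw [hgf'] at h2
      exact h2 hy
  let Z : Set M := (A \ g ⁻¹' A) ∩ ⋂ n : ℕ, f^[n] ⁻¹' A
  have hZm : MeasurableSet Z :=
    (hA.diff (hg.measurable hA)).inter
      (MeasurableSet.iInter fun n => (hf.measurable.iterate n) hA)
  have hZA : ∀ z ∈ Z, ∀ n, f^[n] z ∈ A := fun z hz n => Set.mem_iInter.1 hz.2 n
  have hmeas : ∀ i, μ (g^[i] ⁻¹' Z) = μ Z := fun i =>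
    (hg.iterate i).measure_preimage hZm.nullMeasurableSet
  have hdis' : ∀ i k x, i < k → g^[i] x ∈ Z → g^[k] x ∈ Z → False := by
    intro i k x hik h1 h2
    obtain ⟨d, rfl⟩ : ∃ d, k = d + (i + 1) := ⟨k - (i + 1), by omega⟩
    have h3 := hZA _ h2 d
    rw [key2, Function.iterate_succ_apply'] at h3
    exact h1.1.2 h3
  have hdis : Pairwise (Function.onFun Disjoint fun i : ℕ => g^[i] ⁻¹' Z) := by
    intro i k hik
    refine Set.disjoint_left.2 fun x h1 h2 => ?_
    rcases lt_or_gt_of_ne hik with h | h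
    · exact hdis' i k x h h1 h2
    · exact hdis' k i x h h2 h1
  have hsub : (⋃ i : ℕ, g^[i] ⁻¹' Z) ⊆ A := by
    refine Set.iUnion_subset fun i x hx => ?_
    have h3 := hZA _ hx i
    rwa [show g^[i] x = g^[i + 0] x from rfl, key2] at h3
  have hZ0 : μ Z = 0 := by
    by_contra hne
    have h1 := measure_mono (μ := μ) hsub
    rw [measure_iUnion hdis (fun i => (hg.measurable.iterate i) hZm)] at h1
    simp only [hmeas] at h1
    rw [ENNReal.tsum_const_eq_top_of_ne_zero hne] at h1
    exact hAfin (top_le_iff.1 h1)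
  refine measure_mono_null (t := ⋃ i : ℕ, g^[i] ⁻¹' Z) ?_
    (measure_iUnion_null fun i => (hmeas i).trans hZ0)
  rintro a (⟨⟨haA, hat⟩, hnu⟩ | ⟨hu, hna⟩)
  · obtain ⟨m, -, hm1, hmA, hlt⟩ := exitTime_spec' g A a hat
    have hlt' : ∀ n, n < m → g^[n] a ∈ A := by
      intro n hn
      rcases Nat.eq_zero_or_pos n with rfl | h
      · exact haA
      · exact hlt n h hn
    obtain ⟨q, rfl⟩ : ∃ q, m = q + 1 := ⟨m - 1, by omega⟩
    rw [Function.iterate_succ_apply'] at hmA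
    have hqA := hlt' q (by omega)
    refine Set.mem_iUnion.2 ⟨q, ?_⟩
    by_cases ht : exitTime f A (g^[q] a) = ⊤
    · rw [exitTime_eq_top_iff'] at ht
      refine ⟨⟨hqA, hmA⟩, Set.mem_iInter.2 fun n => ?_⟩
      rcases Nat.eq_zero_or_pos n with rfl | h
      · exact hqA
      · exact ht n h
    · exfalso
      obtain ⟨j, hj, hj1, hjA, -⟩ := exitTime_spec' f A _ ht
      apply hnu
      simp only [Set.mem_iUnion]
      refine ⟨j, hj1, q, ?_, g^[q] a, ⟨(hent _).2 ⟨hqA, hmA⟩, hj⟩, key2 q 0 a⟩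
      by_contra hc
      obtain ⟨d, rfl⟩ : ∃ d, q = j + d := ⟨q - j, by omega⟩
      rw [key2] at hjA
      exact hjA (hlt' d (by omega))
  · exfalso
    apply hna
    simp only [Set.mem_iUnion] at hu
    obtain ⟨j, hj1, i, hij, z, ⟨hzI, hzj⟩, rfl⟩ := hu
    rw [hent] at hzI
    obtain ⟨j', hj', -, -, hlt⟩ := exitTime_spec' f A z (by rw [hzj]; exact ENat.coe_ne_top j)
    have hjj : j = j' := by
      rw [hzj] at hj'
      exact_mod_cast hj'
    subst hjj
    refine ⟨?_, ?_⟩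
    · rcases Nat.eq_zero_or_pos i with rfl | h
      · exact hzI.1
      · exact hlt i h hij
    · rw [Ne, exitTime_eq_top_iff']
      intro h
      have h2 := h (i + 1) (by omega)
      rw [Function.iterate_succ_apply'] at h2
      have h3 : g^[i] (f^[i] z) = z := key1 i 0 z
      rw [h3] at h2
      exact hzI.2 h2
end

section
/- The measure of the accessible set is given by μ(A_acc) = Σ_{j=1}^∞ j · μ(T_j); in particular this sum converges since μ(A_acc) ≤ μ(A) < ∞. -/
open MeasureTheory ENNReal NNReal

theorem exitTime_ne_top_iff {M : Type*} (f : M → M) (A : Set M) (a : M) :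
    exitTime f A a ≠ ⊤ ↔ ∃ n, 1 ≤ n ∧ f^[n] a ∉ A := by
  simp [exitTime, sInf_eq_top]

theorem exitTime_eq_iff {M : Type*} (f : M → M) (A : Set M) (a : M) (n : ℕ) :
    exitTime f A a = ((n + 1 : ℕ) : ℕ∞) ↔
      f^[n + 1] a ∉ A ∧ ∀ k, 1 ≤ k → k ≤ n → f^[k] a ∈ A := by
  constructor
  · intro h
    have hlow : ∀ k, 1 ≤ k → k ≤ n → f^[k] a ∈ A := by
      intro k hk hkn
      by_contra hc
      have h1 : exitTime f A a ≤ (k : ℕ∞) := sInf_le ⟨k, ⟨hk, hc⟩, rfl⟩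
      rw [h] at h1
      have := Nat.cast_le.mp h1
      omega
    refine ⟨?_, hlow⟩
    intro hc
    have h1 : ((n + 2 : ℕ) : ℕ∞) ≤ exitTime f A a := by
      apply le_sInf
      rintro _ ⟨k, ⟨hk, hkA⟩, rfl⟩
      apply Nat.cast_le.mpr
      by_contra hlt
      rcases Nat.lt_or_ge n k with h2 | h2
      · have : k = n + 1 := by omega
        subst this
        exact hkA hc
      · exact hkA (hlow k hk h2)
    rw [h] at h1
    have := Nat.cast_le.mp h1
    omega
  · rintro ⟨h1, h2⟩
    apply le_antisymm
    · exact sInf_le ⟨n + 1, ⟨by omega, h1⟩, rfl⟩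
    · apply le_sInf
      rintro _ ⟨k, ⟨hk, hkA⟩, rfl⟩
      apply Nat.cast_le.mpr
      by_contra hlt
      exact hkA (h2 k hk (by omega))

/-- Entry points that remain in `A` for times `0, …, i`. -/
def stayE {M : Type*} (f g : M → M) (A : Set M) (i : ℕ) : Set M :=
  {x | g x ∉ A ∧ ∀ k, k ≤ i → f^[k] x ∈ A}

theorem mem_transitComp_iff {M : Type*} (f g : M → M) (hgf : Function.LeftInverse g f)
    (hfg : Function.RightInverse g f) (A : Set M) (j : ℕ) (x : M) :
    x ∈ transitComp f A (j + 1) ↔ x ∈ stayE f g A j ∧ f^[j + 1] x ∉ A := by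
  have him : x ∈ f '' A ↔ g x ∈ A := by
    constructor
    · rintro ⟨y, hy, rfl⟩
      rwa [hgf y]
    · intro h
      exact ⟨g x, h, hfg x⟩
  unfold transitComp entrySet stayE
  simp only [Set.mem_setOf_eq, Set.mem_diff, him]
  rw [exitTime_eq_iff]
  constructor
  · rintro ⟨⟨h1, h2⟩, h3, h4⟩
    refine ⟨⟨h2, fun k hk => ?_⟩, h3⟩
    rcases Nat.eq_zero_or_pos k with rfl | h
    · exact h1
    · exact h4 k h hk
  · rintro ⟨⟨h2, h4⟩, h3⟩
    exact ⟨⟨h4 0 (Nat.zero_le _), h2⟩, h3, fun k _ hk => h4 k hk⟩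

theorem measurable_stayE {M : Type*} [MeasurableSpace M] (f g : M → M) (hf : Measurable f)
    (hg : Measurable g) (A : Set M) (hA : MeasurableSet A) (i : ℕ) :
    MeasurableSet (stayE f g A i) := by
  have : stayE f g A i = (g ⁻¹' A)ᶜ ∩ ⋂ k, ⋂ (_ : k ≤ i), f^[k] ⁻¹' A := by
    ext x; simp [stayE]
  rw [this]
  exact (hg hA).compl.inter
    (MeasurableSet.iInter fun k => MeasurableSet.iInter fun _ => (hf.iterate k) hA)

theorem mem_preimage_stayE {M : Type*} (f g : M → M) (hfg : Function.RightInverse g f)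
    (A : Set M) (i : ℕ) (x : M) :
    x ∈ g^[i] ⁻¹' stayE f g A i ↔ g^[i + 1] x ∉ A ∧ ∀ k, k ≤ i → g^[k] x ∈ A := by
  have key : ∀ k, k ≤ i → f^[k] (g^[i] x) = g^[i - k] x := by
    intro k hk
    obtain ⟨m, rfl⟩ := Nat.exists_eq_add_of_le hk
    rw [Function.iterate_add_apply, Nat.add_sub_cancel_left]
    exact (Function.LeftInverse.iterate hfg k) _
  simp only [stayE, Set.mem_preimage, Set.mem_setOf_eq, Function.iterate_succ_apply']
  refine and_congr Iff.rfl ⟨fun h k hk => ?_, fun h k hk => ?_⟩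
  · have := h (i - k) (by omega)
    rw [key _ (by omega)] at this
    rwa [show i - (i - k) = k by omega] at this
  · rw [key k hk]
    exact h _ (by omega)

theorem accSet_eq_iUnion {M : Type*} (f g : M → M) (hfg : Function.RightInverse g f)
    (A : Set M) : accSet g A = ⋃ i, g^[i] ⁻¹' stayE f g A i := by
  classical
  ext x
  rw [Set.mem_iUnion]
  simp only [mem_preimage_stayE f g hfg]
  unfold accSet
  rw [Set.mem_setOf_eq, exitTime_ne_top_iff]
  constructor
  · rintro ⟨hx, n, -, hn⟩
    have hex : ∃ n, g^[n] x ∉ A := ⟨n, hn⟩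
    have hs := Nat.find_spec hex
    have hm : ∀ k, k < Nat.find hex → g^[k] x ∈ A := fun k hk =>
      not_not.mp (Nat.find_min hex hk)
    rcases h : Nat.find hex with _ | m
    · rw [h] at hs
      exact absurd hx hs
    · rw [h] at hs hm
      exact ⟨m, hs, fun k hk => hm k (by omega)⟩
  · rintro ⟨i, h1, h2⟩
    exact ⟨h2 0 (Nat.zero_le _), i + 1, by omega, h1⟩

theorem measure_accSet_eq_tsum_stayE {M : Type*} [MeasurableSpace M] (μ : Measure M)
    (f g : M → M) (hfg : Function.RightInverse g f)
    (hf : MeasurePreserving f μ μ) (hg : MeasurePreserving g μ μ)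
    (A : Set M) (hA : MeasurableSet A) :
    μ (accSet g A) = ∑' i, μ (stayE f g A i) := by
  have hm := measurable_stayE f g hf.measurable hg.measurable A hA
  rw [accSet_eq_iUnion f g hfg, measure_iUnion]
  · refine tsum_congr fun i => ?_
    exact (hg.iterate i).measure_preimage (hm i).nullMeasurableSet
  · have aux : ∀ i j, i < j → ∀ x, x ∈ g^[i] ⁻¹' stayE f g A i →
        x ∉ g^[j] ⁻¹' stayE f g A j := by
      intro i j hij x hi hj
      rw [mem_preimage_stayE f g hfg] at hi hj
      exact hi.1 (hj.2 (i + 1) hij)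
    intro i j hij
    refine Set.disjoint_left.mpr fun x hi hj => ?_
    rcases lt_or_gt_of_ne hij with h | h
    · exact aux i j h x hi hj
    · exact aux j i h x hj hi
  · exact fun i => (hg.measurable.iterate i) (hm i)

theorem measure_stayE_eq {M : Type*} [MeasurableSpace M] (μ : Measure M)
    (f g : M → M) (hgf : Function.LeftInverse g f) (hfg : Function.RightInverse g f)
    (hf : Measurable f) (hg : Measurable g)
    (A : Set M) (hA : MeasurableSet A) (h0 : μ (⋂ i, stayE f g A i) = 0) (i : ℕ) :
    μ (stayE f g A i) = ∑' j, if i ≤ j then μ (transitComp f A (j + 1)) else 0 := by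
  classical
  have hm := measurable_stayE f g hf hg A hA
  have hT : ∀ j, MeasurableSet (transitComp f A (j + 1)) := by
    intro j
    have : transitComp f A (j + 1) = stayE f g A j \ f^[j + 1] ⁻¹' A := by
      ext x
      rw [mem_transitComp_iff f g hgf hfg]
      rfl
    rw [this]
    exact (hm j).diff ((hf.iterate _) hA)
  have hU : stayE f g A i \ (⋂ i, stayE f g A i)
      = ⋃ j, if i ≤ j then transitComp f A (j + 1) else ∅ := by
    ext x
    simp only [Set.mem_diff, Set.mem_iInter, Set.mem_iUnion]
    constructor
    · rintro ⟨h1, h2⟩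
      have hex : ∃ n, f^[n] x ∉ A := by
        by_contra hc
        push Not at hc
        exact h2 fun i => ⟨h1.1, fun k _ => hc k⟩
      have hs := Nat.find_spec hex
      have hmin : ∀ k, k < Nat.find hex → f^[k] x ∈ A := fun k hk =>
        not_not.mp (Nat.find_min hex hk)
      have hlt : i < Nat.find hex := by
        by_contra hc
        exact hs (h1.2 _ (by omega))
      obtain ⟨m, h⟩ : ∃ m, Nat.find hex = m + 1 := ⟨Nat.find hex - 1, by omega⟩
      rw [h] at hs hmin hlt
      refine ⟨m, ?_⟩
      rw [if_pos (by omega), mem_transitComp_iff f g hgf hfg]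
      exact ⟨⟨h1.1, fun k hk => hmin k (by omega)⟩, hs⟩
    · rintro ⟨j, hj⟩
      split_ifs at hj with hij
      · rw [mem_transitComp_iff f g hgf hfg] at hj
        exact ⟨⟨hj.1.1, fun k hk => hj.1.2 k (by omega)⟩,
          fun h => hj.2 ((h (j + 1)).2 _ le_rfl)⟩
      · exact absurd hj (Set.notMem_empty x)
  rw [← measure_diff_null h0, hU, measure_iUnion]
  · refine tsum_congr fun j => ?_
    split_ifs <;> simp
  · have aux : ∀ j k, j < k → ∀ x, x ∈ transitComp f A (j + 1) →
        x ∉ transitComp f A (k + 1) := by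
      intro j k hjk x h1 h2
      rw [mem_transitComp_iff f g hgf hfg] at h1 h2
      exact h1.2 (h2.1.2 _ hjk)
    intro j k hjk
    refine Set.disjoint_left.mpr fun x h1 h2 => ?_
    beta_reduce at h1 h2
    split_ifs at h1 h2
    all_goals first
      | exact absurd h1 (Set.notMem_empty x)
      | exact absurd h2 (Set.notMem_empty x)
      | skip
    rcases lt_or_gt_of_ne hjk with h | h
    · exact aux j k h x h1 h2
    · exact aux k j h x h2 h1
  · intro j
    split_ifs
    · exact hT j
    · exact MeasurableSet.empty

/-- μ(A_acc) = Σ_{j=1}^∞ j · μ(T_j); in particular the sum converges since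
μ(A_acc) ≤ μ(A) < ∞. -/
theorem measure_accSet_eq_tsum {M : Type*} [MeasurableSpace M] (μ : Measure M)
    (f g : M → M) (hgf : Function.LeftInverse g f) (hfg : Function.RightInverse g f)
    (hf : MeasurePreserving f μ μ) (hg : MeasurePreserving g μ μ)
    (A : Set M) (hA : MeasurableSet A) (hAfin : μ A ≠ ⊤) :
    μ (accSet g A) = ∑' j : ℕ, ((j + 1 : ℕ) : ℝ≥0∞) * μ (transitComp f A (j + 1)) ∧
      ∑' j : ℕ, ((j + 1 : ℕ) : ℝ≥0∞) * μ (transitComp f A (j + 1)) ≠ ⊤ := by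
  have hfin : μ (accSet g A) ≠ ⊤ :=
    ne_top_of_le_ne_top hAfin (measure_mono fun x hx => hx.1)
  have hsum := measure_accSet_eq_tsum_stayE μ f g hfg hf hg A hA
  have h0 : μ (⋂ i, stayE f g A i) = 0 := by
    by_contra hne
    apply hfin
    rw [hsum, ← top_le_iff, ← ENNReal.tsum_const_eq_top_of_ne_zero (α := ℕ) hne]
    exact ENNReal.tsum_le_tsum fun i => measure_mono (Set.iInter_subset _ i)
  have main : μ (accSet g A)
      = ∑' j : ℕ, ((j + 1 : ℕ) : ℝ≥0∞) * μ (transitComp f A (j + 1)) := by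
    rw [hsum, tsum_congr (measure_stayE_eq μ f g hgf hfg hf.measurable hg.measurable A hA h0),
      ENNReal.tsum_comm]
    refine tsum_congr fun j => ?_
    rw [tsum_eq_sum (s := Finset.range (j + 1))]
    · rw [Finset.sum_congr rfl (g := fun _ => μ (transitComp f A (j + 1)))]
      · simp
      · intro i hi
        rw [Finset.mem_range] at hi
        exact if_pos (by omega)
    · intro i hi
      rw [Finset.mem_range] at hi
      exact if_neg (by omega)
  exact ⟨main, main ▸ hfin⟩
end

section
/- (Generalized Kac formula) Suppose μ(M) = 1. Then the integral over A of the first return time equals the measure of the set accessible from A: ∫_A t_return dμ = μ(⋃_{n≥0} fⁿ(A)). Equivalently, if μ(A) > 0, the average first return time is ⟨t_return⟩_A = μ(M_acc)/μ(A), where M_acc = ⋃_{n≥0} fⁿ(A). -/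
open MeasureTheory ENNReal NNReal

/-- First return time to `A` under `f`: the least `n ≥ 1` with `f^[n] a ∈ A`
(`⊤` if no such `n` exists). -/
noncomputable def returnTime {M : Type*} (f : M → M) (A : Set M) (a : M) : ℕ∞ :=
  sInf ((fun n : ℕ => (n : ℕ∞)) '' {n : ℕ | 1 ≤ n ∧ f^[n] a ∈ A})

theorem enat_eq_tsum (t : ℕ∞) :
    (t : ℝ≥0∞) = ∑' n : ℕ, (if (n : ℕ∞) < t then (1 : ℝ≥0∞) else 0) := by
  induction t using ENat.recTopCoe with
  | top =>
    simp [ENNReal.tsum_const_eq_top_of_ne_zero]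
  | coe m =>
    rw [tsum_eq_sum (s := Finset.range m)]
    · rw [Finset.sum_congr rfl (g := fun _ => (1 : ℝ≥0∞))]
      · simp
      · intro x hx
        simp at hx
        simp [hx]
    · intro b hb
      simp at hb
      simp [hb]

theorem lt_returnTime_iff {M : Type*} (f : M → M) (A : Set M) (a : M) (n : ℕ) :
    (n : ℕ∞) < returnTime f A a ↔ ∀ k : ℕ, 1 ≤ k → k ≤ n → f^[k] a ∉ A := by
  rw [← ENat.add_one_le_iff (ENat.coe_ne_top n), returnTime, le_sInf_iff]
  constructor
  · intro h k hk hkn hkA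
    have := h k ⟨k, ⟨hk, hkA⟩, rfl⟩
    have h2 : n + 1 ≤ k := by exact_mod_cast this
    omega
  · rintro h _ ⟨k, ⟨hk, hkA⟩, rfl⟩
    by_contra hc
    apply h k hk _ hkA
    have : ¬ (n + 1 ≤ k) := by
      intro h3
      exact hc (by simpa using (by exact_mod_cast h3 : ((n + 1 : ℕ) : ℕ∞) ≤ k))
    omega

theorem kac_aux {M : Type*} [MeasurableSpace M] (μ : Measure M)
    (f g : M → M) (hgf : Function.LeftInverse g f) (hfg : Function.RightInverse g f)
    (hf : MeasurePreserving f μ μ) (hg : MeasurePreserving g μ μ)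
    (A : Set M) (hA : MeasurableSet A) :
    ∫⁻ a in A, (returnTime f A a : ℝ≥0∞) ∂μ = μ (⋃ n : ℕ, f^[n] '' A) := by
  have hD : ∀ n : ℕ, f^[n] '' A = g^[n] ⁻¹' A := fun n =>
    congrFun (Set.image_eq_preimage_of_inverse (hgf.iterate n) (hfg.iterate n)) A
  have hDm : ∀ n : ℕ, MeasurableSet (f^[n] '' A) := fun n => by
    rw [hD]; exact (hg.measurable.iterate n) hA
  have hB : ∀ n : ℕ, MeasurableSet {a | (n : ℕ∞) < returnTime f A a} := fun n => by
    simp only [lt_returnTime_iff, Set.setOf_forall]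
    exact MeasurableSet.iInter fun k => MeasurableSet.iInter fun _ => MeasurableSet.iInter fun _ =>
      ((hf.measurable.iterate k) hA).compl
  have hite : ∀ n : ℕ, (fun a => if (n : ℕ∞) < returnTime f A a then (1 : ℝ≥0∞) else 0)
      = {a | (n : ℕ∞) < returnTime f A a}.indicator 1 := fun n => by
    ext a; simp [Set.indicator_apply]
  have hcomm : ∀ (j n : ℕ) (a : M), j ≤ n → g^[j] (f^[n] a) = f^[n - j] a := by
    intro j n a hj
    conv_lhs => rw [← Nat.add_sub_cancel' hj, Function.iterate_add_apply]
    exact hgf.iterate j _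
  simp only [enat_eq_tsum]
  rw [lintegral_tsum (fun n => by
    rw [hite]; exact (measurable_one.indicator (hB n)).aemeasurable)]
  rw [← iUnion_disjointed, measure_iUnion (disjoint_disjointed _) (MeasurableSet.disjointed hDm)]
  congr 1
  ext n
  rw [hite, lintegral_indicator_one (hB n), Measure.restrict_apply (hB n),
    ← (hf.iterate n).measure_preimage (MeasurableSet.disjointed hDm n).nullMeasurableSet]
  congr 1
  ext a
  simp only [disjointed_eq_inter_compl, hD, Set.mem_inter_iff, Set.mem_setOf_eq,
    lt_returnTime_iff, Set.mem_preimage, Set.mem_iInter, Set.mem_compl_iff]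
  rw [hcomm n n a le_rfl, and_comm]
  simp only [Nat.sub_self, Function.iterate_zero, id]
  refine and_congr_right fun _ => ⟨fun h j hj => ?_, fun h k hk hkn => ?_⟩
  · rw [hcomm j n a hj.le]
    exact h _ (by omega) (by omega)
  · have := h (n - k) (by omega)
    rwa [hcomm _ n a (by omega), Nat.sub_sub_self hkn] at this

/-- Generalized Kac formula: on a probability space, `∫_A t_return dμ = μ(M_acc)`
where `M_acc = ⋃_{n ≥ 0} fⁿ(A)`; hence if `μ(A) > 0` the average first return time
is `μ(M_acc)/μ(A)`. -/
theorem kac_return_time {M : Type*} [MeasurableSpace M] (μ : Measure M)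
    [IsProbabilityMeasure μ]
    (f g : M → M) (hgf : Function.LeftInverse g f) (hfg : Function.RightInverse g f)
    (hf : MeasurePreserving f μ μ) (hg : MeasurePreserving g μ μ)
    (A : Set M) (hA : MeasurableSet A) :
    (∫⁻ a in A, (returnTime f A a : ℝ≥0∞) ∂μ = μ (⋃ n : ℕ, f^[n] '' A)) ∧
    (0 < μ A →
      (μ A)⁻¹ * ∫⁻ a in A, (returnTime f A a : ℝ≥0∞) ∂μ
        = μ (⋃ n : ℕ, f^[n] '' A) / μ A) := by
  have h := kac_aux μ f g hgf hfg hf hg A hA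
  refine ⟨h, fun _ => ?_⟩
  rw [h, ENNReal.div_eq_inv_mul]
end

section
/- (Corollary 3, transit time version) The integral of the transit time over the accessible set satisfies ∫_{A_acc} t_transit dμ = Σ_{j=1}^∞ j² · μ(T_j), as an equality in [0, ∞] (both sides may be infinite). -/
open MeasureTheory ENNReal NNReal

lemma le_exit {M : Type*} (f : M → M) (A : Set M) (a : M) (n : ℕ) :
    (n : ℕ∞) ≤ exitTime f A a ↔ ∀ m, 1 ≤ m → m < n → f^[m] a ∈ A := by
  unfold exitTime
  rw [le_sInf_iff]
  constructor
  · intro h m hm hmn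
    by_contra hc
    have := h (m : ℕ∞) ⟨m, ⟨hm, hc⟩, rfl⟩
    have : n ≤ m := by exact_mod_cast this
    omega
  · rintro h _ ⟨m, ⟨hm, hc⟩, rfl⟩
    have : n ≤ m := by
      by_contra hl
      exact hc (h m hm (by omega))
    exact Nat.cast_le.2 this

lemma eq_iff_le {x : ℕ∞} (n : ℕ) : x = n ↔ (n : ℕ∞) ≤ x ∧ ¬ ((n + 1 : ℕ) : ℕ∞) ≤ x := by
  induction x using ENat.recTopCoe with
  | top => simp
  | coe k => norm_cast; omega

lemma exit_meas {M : Type*} [MeasurableSpace M] (f : M → M) (hf : Measurable f) (A : Set M)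
    (hA : MeasurableSet A) : Measurable (exitTime f A) := by
  have h : ∀ n : ℕ, MeasurableSet {a | (n : ℕ∞) ≤ exitTime f A a} := by
    intro n
    simp only [le_exit]
    have : {a | ∀ m, 1 ≤ m → m < n → f^[m] a ∈ A}
        = ⋂ m, ⋂ (_ : 1 ≤ m), ⋂ (_ : m < n), f^[m] ⁻¹' A := by ext; simp
    rw [this]
    exact MeasurableSet.iInter fun m => MeasurableSet.iInter fun _ => MeasurableSet.iInter fun _ =>
      hf.iterate m hA
  rw [ENat.measurable_iff]
  intro n
  have : exitTime f A ⁻¹' {(n : ℕ∞)} =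
      {a | (n : ℕ∞) ≤ exitTime f A a} \ {a | ((n + 1 : ℕ) : ℕ∞) ≤ exitTime f A a} := by
    ext a
    simp only [Set.mem_preimage, Set.mem_singleton_iff, eq_iff_le]
    rfl
  rw [this]
  exact (h n).diff (h _)

lemma mem_entry {M : Type*} (f g : M → M) (hgf : Function.LeftInverse g f)
    (hfg : Function.RightInverse g f) (A : Set M) (b : M) :
    b ∈ entrySet f A ↔ b ∈ A ∧ g b ∉ A := by
  rw [entrySet, Set.image_eq_preimage_of_inverse hgf hfg]; rfl

/-- entry points with exit time larger than `n` -/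
def slice {M : Type*} (f : M → M) (A : Set M) (n : ℕ) : Set M :=
  {b ∈ entrySet f A | ((n + 1 : ℕ) : ℕ∞) ≤ exitTime f A b}

lemma iter_lem {M : Type*} (f g : M → M) 
    (hfg : Function.RightInverse g f) (a : M) (n m : ℕ) (h : m ≤ n) :
    f^[m] (g^[n] a) = g^[n - m] a := by
  obtain ⟨k, rfl⟩ := Nat.exists_eq_add_of_le h
  rw [Function.iterate_add_apply, (hfg.iterate m) _]
  simp

lemma iter_lem2 {M : Type*} (f g : M → M) 
    (hfg : Function.RightInverse g f) (a : M) (n m : ℕ) :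
    f^[m + n] (g^[n] a) = f^[m] a := by
  rw [Function.iterate_add_apply, (hfg.iterate n) _]

lemma slice_pre {M : Type*} (f g : M → M) (hgf : Function.LeftInverse g f)
    (hfg : Function.RightInverse g f) (A : Set M) (n : ℕ) :
    g^[n] ⁻¹' slice f A n = {a ∈ A | exitTime g A a = ((n + 1 : ℕ) : ℕ∞)} := by
  ext a
  simp only [Set.mem_preimage, slice, Set.mem_setOf_eq, mem_entry f g hgf hfg, eq_iff_le, le_exit,
    ← Function.iterate_succ_apply' g]
  constructor
  · rintro ⟨⟨h1, h2⟩, h3⟩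
    have key : ∀ m, m ≤ n → g^[m] a ∈ A := by
      intro m hm
      rcases Nat.eq_or_lt_of_le hm with rfl | hlt
      · exact h1
      · have := h3 (n - m) (by omega) (by omega)
        rwa [iter_lem f g hfg _ _ _ (by omega), show n - (n - m) = m by omega] at this
    refine ⟨key 0 (by omega), fun m _ hm => key m (by omega), fun h => h2 (h _ (by omega) (by omega))⟩
  · rintro ⟨h1, h2, h3⟩
    have key : ∀ m, m ≤ n → g^[m] a ∈ A := by
      intro m hm
      rcases Nat.eq_zero_or_pos m with rfl | hp
      · exact h1
      · exact h2 m hp (by omega)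
    refine ⟨⟨key n le_rfl, fun h => h3 fun m hm hmn => ?_⟩, fun m hm hmn => ?_⟩
    · rcases Nat.lt_or_ge n m with hl | hl
      · rwa [show m = n.succ by omega]
      · exact key m hl
    · rw [iter_lem f g hfg _ _ _ (by omega)]
      exact key _ (by omega)

lemma transit_eq {M : Type*} (f g : M → M) (hgf : Function.LeftInverse g f)
    (hfg : Function.RightInverse g f) (A : Set M) (n : ℕ) (a : M) (ha : g^[n] a ∈ slice f A n) :
    transitTime f g A a = exitTime f A (g^[n] a) := by
  have h1 : a ∈ g^[n] ⁻¹' slice f A n := ha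
  rw [slice_pre f g hgf hfg] at h1
  obtain ⟨hA, hb⟩ := h1
  have hs : ((n + 1 : ℕ) : ℕ∞) ≤ exitTime f A (g^[n] a) := ha.2
  have hs' := (le_exit _ _ _ _).1 hs
  have h2 : ∀ k : ℕ, ((k + n : ℕ) : ℕ∞) ≤ exitTime f A (g^[n] a) ↔ (k : ℕ∞) ≤ exitTime f A a := by
    intro k
    rw [le_exit, le_exit]
    constructor
    · intro h m hm hmk
      have := h (m + n) (by omega) (by omega)
      rwa [iter_lem2 f g hfg] at this
    · intro h m hm hmk
      rcases Nat.lt_or_ge n m with hl | hl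
      · obtain ⟨k', rfl⟩ := Nat.exists_eq_add_of_le' hl.le
        rw [iter_lem2 f g hfg]
        exact h _ (by omega) (by omega)
      · exact hs' m hm (by omega)
  unfold transitTime
  rw [hb]
  generalize exitTime f A a = x at *
  generalize exitTime f A (g^[n] a) = y at *
  have h3 : x + ((n + 1 : ℕ) : ℕ∞) - 1 = x + n := by
    induction x using ENat.recTopCoe with
    | top => rfl
    | coe k => norm_cast
  rw [h3]
  induction y using ENat.recTopCoe with
  | top =>
    induction x using ENat.recTopCoe with
    | top => rfl
    | coe k => 
      have := (h2 (k + 1)).1 le_top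
      norm_cast at this; omega
  | coe l =>
    norm_cast at h2 hs
    have := (h2 (l - n)).1 (by omega)
    have h4 := mt (h2 (l - n + 1)).2 (by omega)
    have h5 := (eq_iff_le (x := x) (l - n)).2 ⟨this, h4⟩
    rw [h5]; norm_cast; omega

lemma tsum_ind (x : ℕ∞) :
    ∑' n : ℕ, (if ((n + 1 : ℕ) : ℕ∞) ≤ x then (1 : ℝ≥0∞) else 0) = (x : ℝ≥0∞) := by
  induction x using ENat.recTopCoe with
  | top => simp [ENNReal.tsum_const_eq_top_of_ne_zero]
  | coe k =>
    rw [tsum_eq_sum (s := Finset.range k)]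
    · rw [Finset.sum_congr rfl (g := fun _ => (1 : ℝ≥0∞))]
      · simp
      · intro n hn
        rw [if_pos]
        have := Finset.mem_range.1 hn
        exact_mod_cast this
    · intro n hn
      rw [if_neg]
      have := mt Finset.mem_range.2 hn
      exact_mod_cast this

lemma tsum_slice {M : Type*} [MeasurableSpace M] (μ : Measure M) (f : M → M) (hf : Measurable f)
    (A : Set M) (hA : MeasurableSet A) (φ : M → ℝ≥0∞) (hφ : Measurable φ) :
    ∑' n, ∫⁻ b in slice f A n, φ b ∂μ
      = ∫⁻ b in entrySet f A, φ b * (exitTime f A b : ℝ≥0∞) ∂μ := by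
  have hm : ∀ n : ℕ, MeasurableSet {b | ((n + 1 : ℕ) : ℕ∞) ≤ exitTime f A b} := fun n =>
    exit_meas f hf A hA (MeasurableSet.of_discrete (s := Set.Ici ((n + 1 : ℕ) : ℕ∞)))
  simp_rw [← tsum_ind, ← ENNReal.tsum_mul_left]
  rw [lintegral_tsum]
  · congr 1; ext n
    rw [slice, Set.setOf_and, Set.inter_comm, ← Measure.restrict_restrict (hm n),
      ← lintegral_indicator (hm n)]
    apply lintegral_congr
    intro b
    simp only [Set.indicator, Set.mem_setOf_eq, mul_ite, mul_one, mul_zero]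
  · intro n
    exact (hφ.mul (Measurable.ite (hm n) measurable_const measurable_const)).aemeasurable

/-- Corollary 3 (transit time version): ∫_{A_acc} t_transit dμ = Σ_{j≥1} j²·μ(T_j),
as an equality in [0,∞]. -/
theorem lintegral_transitTime_accSet {M : Type*} [MeasurableSpace M] (μ : Measure M)
    (f g : M → M) (hgf : Function.LeftInverse g f) (hfg : Function.RightInverse g f)
    (hf : MeasurePreserving f μ μ) (hg : MeasurePreserving g μ μ)
    (A : Set M) (hA : MeasurableSet A) (hAfin : μ A ≠ ⊤) :
    ∫⁻ a in accSet g A, (transitTime f g A a : ℝ≥0∞) ∂μ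
      = ∑' j : ℕ, (((j + 1) ^ 2 : ℕ) : ℝ≥0∞) * μ (transitComp f A (j + 1)) := by
  have hτ := exit_meas f hf.measurable A hA
  have hτ' := exit_meas g hg.measurable A hA
  have hτe : Measurable fun b => (exitTime f A b : ℝ≥0∞) :=
    (Measurable.of_discrete (f := fun x : ℕ∞ => (x : ℝ≥0∞))).comp hτ
  have hI : MeasurableSet (entrySet f A) := by
    rw [entrySet, Set.image_eq_preimage_of_inverse hgf hfg]
    exact hA.diff (hg.measurable hA)
  have hS : ∀ n, MeasurableSet (slice f A n) := fun n =>
    hI.inter (hτ (MeasurableSet.of_discrete (s := Set.Ici ((n + 1 : ℕ) : ℕ∞))))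
  have hacc : accSet g A = ⋃ n, g^[n] ⁻¹' slice f A n := by
    ext a
    simp only [slice_pre f g hgf hfg, Set.mem_iUnion, accSet, Set.mem_setOf_eq]
    constructor
    · rintro ⟨h1, h2⟩
      obtain ⟨k, hk⟩ := ENat.ne_top_iff_exists.1 h2
      have h3 : ((1 : ℕ) : ℕ∞) ≤ exitTime g A a := (le_exit _ _ _ _).2 (by intros; omega)
      rw [← hk] at h3 ⊢
      norm_cast at h3
      exact ⟨k - 1, h1, by norm_cast; omega⟩
    · rintro ⟨n, h1, h2⟩
      exact ⟨h1, by rw [h2]; exact ENat.coe_ne_top _⟩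
  have hdis : Pairwise (Function.onFun Disjoint fun n => g^[n] ⁻¹' slice f A n) := by
    intro n m hnm
    simp only [Function.onFun, slice_pre f g hgf hfg]
    rw [Set.disjoint_left]
    rintro a ⟨_, h1⟩ ⟨_, h2⟩
    rw [h1] at h2
    norm_cast at h2
    omega
  have hmeas : ∀ n, MeasurableSet (g^[n] ⁻¹' slice f A n) := fun n =>
    hg.measurable.iterate n (hS n)
  -- general formula
  have gen : ∀ (φ ψ : M → ℝ≥0∞), Measurable φ →
      (∀ n a, g^[n] a ∈ slice f A n → ψ a = φ (g^[n] a)) →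
      ∫⁻ a in accSet g A, ψ a ∂μ
        = ∫⁻ b in entrySet f A, φ b * (exitTime f A b : ℝ≥0∞) ∂μ := by
    intro φ ψ hφ h
    rw [hacc, lintegral_iUnion hmeas hdis, ← tsum_slice μ f hf.measurable A hA φ hφ]
    congr 1; ext n
    rw [setLIntegral_congr_fun (hmeas n) (fun a ha => h n a ha)]
    exact (hg.iterate n).setLIntegral_comp_preimage (hS n) hφ
  have hfin : ∫⁻ b in entrySet f A, (exitTime f A b : ℝ≥0∞) ∂μ ≠ ⊤ := by
    have := gen (fun _ => 1) (fun _ => 1) measurable_const (fun _ _ _ => rfl)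
    simp only [one_mul] at this
    rw [← this, lintegral_one, Measure.restrict_apply_univ]
    exact ne_top_of_le_ne_top hAfin (measure_mono fun a ha => ha.1)
  have hae := ae_lt_top hτe hfin
  rw [gen (fun b => (exitTime f A b : ℝ≥0∞)) _ hτe
    (fun n a ha => by rw [transit_eq f g hgf hfg A n a ha])]
  have hlev : ∀ j : ℕ, MeasurableSet {b | exitTime f A b = ((j + 1 : ℕ) : ℕ∞)} := fun j =>
    hτ (MeasurableSet.of_discrete (s := {((j + 1 : ℕ) : ℕ∞)}))
  have hr : ∀ j : ℕ, (((j + 1) ^ 2 : ℕ) : ℝ≥0∞) * μ (transitComp f A (j + 1))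
      = ∫⁻ b in entrySet f A, {b | exitTime f A b = ((j + 1 : ℕ) : ℕ∞)}.indicator
          (fun _ => (((j + 1) ^ 2 : ℕ) : ℝ≥0∞)) b ∂μ := by
    intro j
    rw [lintegral_indicator_const (hlev j), Measure.restrict_apply (hlev j), Set.inter_comm]
    rfl
  simp_rw [hr]
  rw [← lintegral_tsum fun j => (measurable_const.indicator (hlev j)).aemeasurable]
  apply lintegral_congr_ae
  filter_upwards [hae] with b hb
  rw [ENat.toENNReal_lt_top] at hb
  obtain ⟨k, hk⟩ := ENat.ne_top_iff_exists.1 hb.ne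
  have h3 : ((1 : ℕ) : ℕ∞) ≤ exitTime f A b := (le_exit _ _ _ _).2 (by intros; omega)
  simp only [Set.indicator, Set.mem_setOf_eq]
  rw [← hk] at h3 ⊢
  norm_cast at h3
  obtain ⟨l, rfl⟩ := Nat.exists_eq_add_of_le' h3
  rw [tsum_eq_single l]
  · simp [pow_two]
  · intro j hj
    rw [if_neg]
    norm_cast
    omega
end

section
/- (Corollary 3, exit time version) The integral of the forward exit time over the accessible set satisfies ∫_{A_acc} t⁺ dμ = Σ_{j=1}^∞ (j(j+1)/2) · μ(T_j), as an equality in [0, ∞]; equivalently, 2 ∫_{A_acc} t⁺ dμ = ∫_{A_acc} t_transit dμ + μ(A_acc). -/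
open MeasureTheory ENNReal NNReal

theorem enat_succ_inj {a b : ℕ∞} : a + 1 = b + 1 ↔ a = b := by
  constructor
  · intro h
    exact (ENat.addLECancellable_of_ne_top (by simp : (1 : ℕ∞) ≠ ⊤)).inj_left.1 h
  · rintro rfl; rfl

theorem exitTime_of_notMem {M : Type*} (f : M → M) (A : Set M) (a : M) (h : f a ∉ A) :
    exitTime f A a = 1 := by
  apply le_antisymm
  · exact sInf_le ⟨1, ⟨le_refl _, by simpa using h⟩, by simp⟩
  · apply le_sInf
    rintro _ ⟨n, ⟨hn, -⟩, rfl⟩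
    show (1 : ℕ∞) ≤ (n : ℕ∞)
    exact_mod_cast hn

theorem exitTime_of_mem {M : Type*} (f : M → M) (A : Set M) (a : M) (h : f a ∈ A) :
    exitTime f A a = exitTime f A (f a) + 1 := by
  apply le_antisymm
  · rcases Set.eq_empty_or_nonempty {n : ℕ | 1 ≤ n ∧ f^[n] (f a) ∉ A} with h0 | h0
    · have : exitTime f A (f a) = ⊤ := by
        unfold exitTime
        rw [h0]; simp
      rw [this]; simp
    · have := csInf_mem (h0.image (fun n : ℕ => (n : ℕ∞)))
      obtain ⟨n, ⟨hn, hn2⟩, h3⟩ := this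
      have h4 : exitTime f A (f a) = n := h3.symm
      rw [h4]
      exact sInf_le ⟨n + 1, ⟨by omega, by simpa using hn2⟩, by simp⟩
  · apply le_sInf
    rintro _ ⟨n, ⟨hn, hn2⟩, rfl⟩
    obtain ⟨k, rfl⟩ : ∃ k, n = k + 1 := ⟨n - 1, by omega⟩
    have hk : 1 ≤ k := by
      by_contra hk
      have : k = 0 := by omega
      subst this
      exact hn2 (by simpa using h)
    have : exitTime f A (f a) ≤ k := sInf_le ⟨k, ⟨hk, by simpa using hn2⟩, rfl⟩
    push_cast
    gcongr

theorem one_le_exitTime {M : Type*} (f : M → M) (A : Set M) (a : M) :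
    1 ≤ exitTime f A a := by
  by_cases h : f a ∈ A
  · rw [exitTime_of_mem f A a h]; simp
  · rw [exitTime_of_notMem f A a h]

theorem measurableSet_exitTime_nat {M : Type*} [MeasurableSpace M] (f : M → M) (hf : Measurable f)
    (A : Set M) (hA : MeasurableSet A) (n : ℕ) :
    MeasurableSet {a | exitTime f A a = ((n : ℕ∞) + 1)} := by
  induction n with
  | zero =>
    have : {a | exitTime f A a = (((0 : ℕ) : ℕ∞) + 1)} = f ⁻¹' Aᶜ := by
      ext a
      simp only [Set.mem_ofPred_eq, Set.mem_preimage, Set.mem_compl_iff]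
      constructor
      · intro h h2
        rw [exitTime_of_mem f A a h2] at h
        have h3 := one_le_exitTime f A (f a)
        have h4 := enat_succ_inj.1 h
        rw [h4] at h3; simp at h3
      · intro h; simp [exitTime_of_notMem f A a h]
    rw [this]; exact hf hA.compl
  | succ n ih =>
    have : {a | exitTime f A a = (((n + 1 : ℕ) : ℕ∞) + 1)} =
        f ⁻¹' (A ∩ {a | exitTime f A a = ((n : ℕ∞) + 1)}) := by
      ext a
      simp only [Set.mem_ofPred_eq, Set.mem_preimage, Set.mem_inter_iff]
      by_cases h : f a ∈ A
      · rw [exitTime_of_mem f A a h, enat_succ_inj]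
        simp [h]
      · rw [exitTime_of_notMem f A a h]
        simp only [h, false_and, iff_false]
        intro h
        have : (1 : ℕ) = (n + 1) + 1 := by exact_mod_cast h
        omega
    rw [this]; exact hf (hA.inter ih)

theorem exitTime_cases {M : Type*} (f : M → M) (A : Set M) (a : M) :
    exitTime f A a = ⊤ ∨ ∃ n : ℕ, exitTime f A a = (n : ℕ∞) + 1 := by
  by_cases h : exitTime f A a = ⊤
  · exact Or.inl h
  · right
    obtain ⟨n, hn⟩ := ENat.ne_top_iff_exists.1 h
    have := one_le_exitTime f A a
    rw [← hn] at this
    have h1 : 1 ≤ n := by exact_mod_cast this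
    refine ⟨n - 1, ?_⟩
    rw [← hn]
    have : n = (n - 1) + 1 := by omega
    exact_mod_cast this

theorem measurableSet_exitTime_top {M : Type*} [MeasurableSpace M] (f : M → M) (hf : Measurable f)
    (A : Set M) (hA : MeasurableSet A) :
    MeasurableSet {a | exitTime f A a = ⊤} := by
  have : {a | exitTime f A a = ⊤} = (⋃ n : ℕ, {a | exitTime f A a = ((n : ℕ∞) + 1)})ᶜ := by
    ext a
    simp only [Set.mem_ofPred_eq, Set.mem_compl_iff, Set.mem_iUnion]
    constructor
    · rintro h ⟨n, hn⟩
      rw [h] at hn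
      exact absurd hn.symm (by exact_mod_cast ENat.natCast_ne_top (n + 1))
    · intro h
      exact (exitTime_cases f A a).resolve_right h
  rw [this]
  exact (MeasurableSet.iUnion fun n => measurableSet_exitTime_nat f hf A hA n).compl

/-- points with prescribed backward and forward exit times -/
def cell {M : Type*} (f g : M → M) (A : Set M) (k m : ℕ∞) : Set M :=
  {a | a ∈ A ∧ exitTime g A a = k ∧ exitTime f A a = m}

theorem preimage_cell {M : Type*} (f g : M → M) (hgf : Function.LeftInverse g f)
    (A : Set M) (k : ℕ) (m : ℕ∞) (hm : 1 ≤ m) :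
    f ⁻¹' cell f g A ((k : ℕ∞) + 1 + 1) m = cell f g A ((k : ℕ∞) + 1) (m + 1) := by
  ext a
  simp only [cell, Set.mem_preimage, Set.mem_ofPred_eq]
  constructor
  · rintro ⟨h1, h2, h3⟩
    have ha : a ∈ A := by
      by_contra ha
      rw [exitTime_of_notMem g A (f a) (by rwa [hgf a])] at h2
      have : (1 : ℕ) = k + 1 + 1 := by exact_mod_cast h2
      omega
    rw [exitTime_of_mem g A (f a) (by rwa [hgf a]), hgf a,
      enat_succ_inj] at h2
    refine ⟨ha, h2, ?_⟩
    rw [exitTime_of_mem f A a h1, h3]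
  · rintro ⟨ha, h2, h3⟩
    have h1 : f a ∈ A := by
      by_contra h1
      rw [exitTime_of_notMem f A a h1] at h3
      have h5 : (0 : ℕ∞) + 1 = m + 1 := by simpa using h3
      rw [enat_succ_inj] at h5
      rw [← h5] at hm; simp at hm
    refine ⟨h1, ?_, ?_⟩
    · rw [exitTime_of_mem g A (f a) (by rwa [hgf a]), hgf a, h2]
    · rw [exitTime_of_mem f A a h1, enat_succ_inj] at h3
      exact h3

theorem measurableSet_cell {M : Type*} [MeasurableSpace M] (f g : M → M) (hf : Measurable f)
    (hg : Measurable g) (A : Set M) (hA : MeasurableSet A) (k m : ℕ) :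
    MeasurableSet (cell f g A ((k : ℕ∞) + 1) ((m : ℕ∞) + 1)) :=
  hA.inter ((measurableSet_exitTime_nat g hg A hA k).inter (measurableSet_exitTime_nat f hf A hA m))

theorem measurableSet_cell_top {M : Type*} [MeasurableSpace M] (f g : M → M) (hf : Measurable f)
    (hg : Measurable g) (A : Set M) (hA : MeasurableSet A) (k : ℕ) :
    MeasurableSet (cell f g A ((k : ℕ∞) + 1) ⊤) :=
  hA.inter ((measurableSet_exitTime_nat g hg A hA k).inter (measurableSet_exitTime_top f hf A hA))

theorem transitComp_eq {M : Type*} (f g : M → M) (hgf : Function.LeftInverse g f)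
    (hfg : Function.RightInverse g f) (A : Set M) (j : ℕ) :
    transitComp f A j = cell f g A 1 j := by
  ext a
  simp only [transitComp, entrySet, cell, Set.mem_ofPred_eq, Set.mem_sdiff, and_assoc]
  refine and_congr_right fun ha => and_congr_left fun _ => ?_
  have h1 : a ∈ f '' A ↔ g a ∈ A := by
    constructor
    · rintro ⟨b, hb, rfl⟩; rwa [hgf b]
    · intro h; exact ⟨g a, h, hfg a⟩
  rw [h1]
  constructor
  · exact exitTime_of_notMem g A a
  · intro h h2
    rw [exitTime_of_mem g A a h2] at h
    have h5 : exitTime g A (g a) + 1 = 0 + 1 := by simpa using h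
    rw [enat_succ_inj] at h5
    have := one_le_exitTime g A (g a)
    rw [h5] at this; simp at this

theorem measure_cell {M : Type*} [MeasurableSpace M] (μ : Measure M)
    (f g : M → M) (hgf : Function.LeftInverse g f) (hfg : Function.RightInverse g f)
    (hf : MeasurePreserving f μ μ) (hg : Measurable g)
    (A : Set M) (hA : MeasurableSet A) (k m : ℕ) :
    μ (cell f g A ((k : ℕ∞) + 1) ((m : ℕ∞) + 1)) = μ (transitComp f A (k + m + 1)) := by
  induction k generalizing m with
  | zero => rw [transitComp_eq f g hgf hfg]; simp
  | succ k ih =>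
    have h := ih (m + 1)
    have h2 := preimage_cell f g hgf A k ((m : ℕ∞) + 1) (by simp)
    push_cast at h ⊢
    rw [← h2, hf.measure_preimage] at h
    · rw [h]; congr 2; omega
    · have := measurableSet_cell f g hf.measurable hg A hA (k + 1) m
      push_cast at this
      exact this.nullMeasurableSet

theorem cell_disjoint {M : Type*} (f g : M → M) (A : Set M) {k m k' m' : ℕ∞}
    (h : k ≠ k' ∨ m ≠ m') : Disjoint (cell f g A k m) (cell f g A k' m') := by
  rw [Set.disjoint_left]
  rintro a ⟨_, h1, h2⟩ ⟨_, h3, h4⟩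
  rcases h with h | h
  · exact h (h1.symm.trans h3)
  · exact h (h2.symm.trans h4)

theorem natCast_succ_inj {a b : ℕ} (h : (a : ℕ∞) + 1 = (b : ℕ∞) + 1) : a = b := by
  have : a + 1 = b + 1 := by exact_mod_cast h
  omega

theorem measure_cell_top {M : Type*} [MeasurableSpace M] (μ : Measure M)
    (f g : M → M) (hgf : Function.LeftInverse g f)
    (hf : MeasurePreserving f μ μ) (hg : Measurable g)
    (A : Set M) (hA : MeasurableSet A) (hAfin : μ A ≠ ⊤) (k : ℕ) :
    μ (cell f g A ((k : ℕ∞) + 1) ⊤) = 0 := by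
  have key : ∀ k : ℕ, μ (cell f g A ((k : ℕ∞) + 1) ⊤) = μ (cell f g A 1 ⊤) := by
    intro k
    induction k with
    | zero => simp
    | succ k ih =>
      have h2 := preimage_cell f g hgf A k ⊤ le_top
      have := measurableSet_cell_top f g hf.measurable hg A hA (k + 1)
      push_cast at this ⊢
      rw [← hf.measure_preimage this.nullMeasurableSet, h2, ← ih]
      simp
  rw [key]
  by_contra hne
  apply hAfin
  have h1 : ∑' k : ℕ, μ (cell f g A ((k : ℕ∞) + 1) ⊤) ≤ μ A := by
    rw [← measure_iUnion]
    · exact measure_mono (Set.iUnion_subset fun k a ha => ha.1)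
    · intro i j hij
      exact cell_disjoint f g A (Or.inl fun h => hij (natCast_succ_inj h))
    · exact measurableSet_cell_top f g hf.measurable hg A hA
  simp_rw [key] at h1
  rw [ENNReal.tsum_const_eq_top_of_ne_zero hne] at h1
  exact top_le_iff.1 h1

theorem lintegral_accSet {M : Type*} [MeasurableSpace M] (μ : Measure M)
    (f g : M → M) (hgf : Function.LeftInverse g f) (hfg : Function.RightInverse g f)
    (hf : MeasurePreserving f μ μ) (hg : Measurable g)
    (A : Set M) (hA : MeasurableSet A) (hAfin : μ A ≠ ⊤) (F : ℕ∞ → ℕ∞ → ℝ≥0∞) :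
    ∫⁻ a in accSet g A, F (exitTime g A a) (exitTime f A a) ∂μ =
      ∑' p : ℕ × ℕ, F ((p.1 : ℕ∞) + 1) ((p.2 : ℕ∞) + 1) * μ (transitComp f A (p.1 + p.2 + 1)) := by
  have h1 : accSet g A = (⋃ p : ℕ × ℕ, cell f g A ((p.1 : ℕ∞) + 1) ((p.2 : ℕ∞) + 1)) ∪
      ⋃ k : ℕ, cell f g A ((k : ℕ∞) + 1) ⊤ := by
    ext a
    simp only [accSet, cell, Set.mem_ofPred_eq, Set.mem_union, Set.mem_iUnion, Prod.exists]
    constructor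
    · rintro ⟨ha, h⟩
      obtain ⟨k, hk⟩ := (exitTime_cases g A a).resolve_left h
      rcases exitTime_cases f A a with h2 | ⟨m, hm⟩
      · exact Or.inr ⟨k, ha, hk, h2⟩
      · exact Or.inl ⟨k, m, ha, hk, hm⟩
    · rintro (⟨k, m, ha, hk, hm⟩ | ⟨k, ha, hk, hm⟩)
      · exact ⟨ha, by rw [hk]; exact_mod_cast ENat.natCast_ne_top (k + 1)⟩
      · exact ⟨ha, by rw [hk]; exact_mod_cast ENat.natCast_ne_top (k + 1)⟩
  have h0 : μ (⋃ k : ℕ, cell f g A ((k : ℕ∞) + 1) ⊤) = 0 :=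
    measure_iUnion_null fun k => measure_cell_top μ f g hgf hf hg A hA hAfin k
  rw [h1, setLIntegral_congr (union_ae_eq_left_of_ae_eq_empty (ae_eq_empty.2 h0)),
    lintegral_iUnion]
  · refine tsum_congr fun p => ?_
    have hm := measurableSet_cell f g hf.measurable hg A hA p.1 p.2
    rw [← measure_cell μ f g hgf hfg hf hg A hA, ← setLIntegral_const]
    refine setLIntegral_congr_fun hm ?_
    rintro a ⟨_, h2, h3⟩
    simp only [h2, h3]
  · intro p; exact measurableSet_cell f g hf.measurable hg A hA p.1 p.2
  · intro p q hpq
    apply cell_disjoint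
    by_contra! h
    exact hpq (Prod.ext (natCast_succ_inj h.1) (natCast_succ_inj h.2))

theorem tsum_diag (c : ℕ → ℝ≥0∞) :
    ∑' p : ℕ × ℕ, ((p.2 : ℝ≥0∞) + 1) * c (p.1 + p.2 + 1) =
      ∑' j : ℕ, ((((j + 1) * (j + 2) / 2 : ℕ)) : ℝ≥0∞) * c (j + 1) := by
  rw [← (Finset.HasAntidiagonal.sigmaAntidiagonalEquivProd : _ ≃ ℕ × ℕ).tsum_eq, ENNReal.tsum_sigma']
  refine tsum_congr fun n => ?_
  rw [tsum_fintype]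
  simp only [Finset.HasAntidiagonal.sigmaAntidiagonalEquivProd_apply]
  rw [Finset.sum_coe_sort (Finset.HasAntidiagonal.antidiagonal n)
    (fun p : ℕ × ℕ => ((p.2 : ℝ≥0∞) + 1) * c (p.1 + p.2 + 1))]
  have : ∀ p ∈ Finset.HasAntidiagonal.antidiagonal n, ((p.2 : ℝ≥0∞) + 1) * c (p.1 + p.2 + 1)
      = ((p.2 : ℝ≥0∞) + 1) * c (n + 1) := by
    intro p hp
    rw [Finset.HasAntidiagonal.mem_antidiagonal.1 hp]
  rw [Finset.sum_congr rfl this, ← Finset.sum_mul]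
  congr 1
  have h2 : ∑ p ∈ Finset.HasAntidiagonal.antidiagonal n, (p.2 + 1) = (n + 1) * (n + 2) / 2 := by
    rw [Finset.Nat.sum_antidiagonal_eq_sum_range_succ_mk]
    have h3 := Finset.sum_range_reflect (fun i => i + 1) (n + 1)
    have h4 : ∑ i ∈ Finset.range (n + 1), (i + 1) = (n + 1) * (n + 2) / 2 := by
      have := Finset.sum_range_succ' (fun i => i) (n + 1)
      simp only [add_zero] at this
      rw [← this, Finset.sum_range_id]
      simp [mul_comm]
    rw [← h4, ← h3]
    refine Finset.sum_congr rfl fun i hi => ?_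
    simp
  rw [← h2]
  push_cast
  rfl

/-- Corollary 3 (exit time version): ∫_{A_acc} t⁺ dμ = Σ_{j≥1} (j(j+1)/2)·μ(T_j) in [0,∞];
equivalently 2·∫_{A_acc} t⁺ dμ = ∫_{A_acc} t_transit dμ + μ(A_acc). -/
theorem lintegral_exitTime_accSet {M : Type*} [MeasurableSpace M] (μ : Measure M)
    (f g : M → M) (hgf : Function.LeftInverse g f) (hfg : Function.RightInverse g f)
    (hf : MeasurePreserving f μ μ) (hg : MeasurePreserving g μ μ)
    (A : Set M) (hA : MeasurableSet A) (hAfin : μ A ≠ ⊤) :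
    (∫⁻ a in accSet g A, (exitTime f A a : ℝ≥0∞) ∂μ
      = ∑' j : ℕ, ((((j + 1) * (j + 2) / 2 : ℕ)) : ℝ≥0∞) * μ (transitComp f A (j + 1))) ∧
    2 * ∫⁻ a in accSet g A, (exitTime f A a : ℝ≥0∞) ∂μ
      = (∫⁻ a in accSet g A, (transitTime f g A a : ℝ≥0∞) ∂μ) + μ (accSet g A) := by
  have hI := lintegral_accSet μ f g hgf hfg hf hg.measurable A hA hAfin
  have e1 := hI (fun _ m => (m : ℝ≥0∞))
  have e2 := hI (fun k m => ((m + k - 1 : ℕ∞) : ℝ≥0∞))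
  have e3 := hI (fun _ _ => 1)
  simp only [ENat.toENNReal_add, ENat.toENNReal_coe, ENat.toENNReal_one] at e1
  have hsub : ∀ k m : ℕ, ((((m : ℕ∞) + 1 + ((k : ℕ∞) + 1) - 1 : ℕ∞)) : ℝ≥0∞)
      = (m : ℝ≥0∞) + 1 + k := by
    intro k m
    have : ((m : ℕ∞) + 1 + ((k : ℕ∞) + 1) - 1 : ℕ∞) = ((m + 1 + k : ℕ) : ℕ∞) := by
      have h : m + 1 + (k + 1) - 1 = m + 1 + k := by omega
      exact_mod_cast congrArg (fun n : ℕ => (n : ℕ∞)) h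
    rw [this]; simp
  simp only [hsub] at e2
  rw [setLIntegral_one] at e3
  refine ⟨e1.trans (tsum_diag fun j => μ (transitComp f A j)), ?_⟩
  unfold transitTime
  rw [e1, e2, e3, two_mul]
  have hs : ∑' p : ℕ × ℕ, ((p.2 : ℝ≥0∞) + 1) * μ (transitComp f A (p.1 + p.2 + 1))
      = ∑' p : ℕ × ℕ, ((p.1 : ℝ≥0∞) + 1) * μ (transitComp f A (p.1 + p.2 + 1)) := by
    rw [← (Equiv.prodComm ℕ ℕ).tsum_eq]
    refine tsum_congr fun p => ?_
    simp [add_comm p.2 p.1]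
  conv_lhs => rw [hs]; enter [1]; rw [← hs]
  rw [← ENNReal.tsum_add, ← ENNReal.tsum_add]
  refine tsum_congr fun p => ?_
  ring
end

section
/- For every k ≥ 1, the measure of the subset of the accessible set with forward exit time exactly k equals the tail sum of the measures of the transit components: μ({a ∈ A_acc : t⁺(a) = k}) = Σ_{j=k}^∞ μ(T_j). -/
open MeasureTheory ENNReal NNReal

theorem exitTime_eq_coe {M : Type*} (f : M → M) (A : Set M) (a : M) (k : ℕ) :
    exitTime f A a = (k : ℕ∞) ↔
      1 ≤ k ∧ f^[k] a ∉ A ∧ ∀ i, 1 ≤ i → i < k → f^[i] a ∈ A := by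
  unfold exitTime
  constructor
  · intro h
    have hne : ((fun n : ℕ => (n : ℕ∞)) '' {n : ℕ | 1 ≤ n ∧ f^[n] a ∉ A}).Nonempty := by
      by_contra hc
      rw [Set.not_nonempty_iff_eq_empty] at hc
      have ht : (⊤ : ℕ∞) ≤ sInf ((fun n : ℕ => (n : ℕ∞)) '' {n : ℕ | 1 ≤ n ∧ f^[n] a ∉ A}) :=
        le_sInf fun b hb => by rw [hc] at hb; exact absurd hb (Set.notMem_empty b)
      rw [h] at ht
      exact absurd (top_le_iff.mp ht) (ENat.natCast_ne_top k)
    have hm := csInf_mem hne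
    rw [h] at hm
    obtain ⟨n, ⟨h1, h2⟩, h3⟩ := hm
    have h3' : n = k := Nat.cast_injective (R := ℕ∞) h3
    subst h3'
    refine ⟨h1, h2, fun i hi hin => ?_⟩
    by_contra hc
    have : sInf ((fun n : ℕ => (n : ℕ∞)) '' {n : ℕ | 1 ≤ n ∧ f^[n] a ∉ A}) ≤ (i : ℕ∞) :=
      sInf_le ⟨i, ⟨hi, hc⟩, rfl⟩
    rw [h] at this
    have : n ≤ i := by exact_mod_cast this
    omega
  · rintro ⟨h1, h2, h3⟩
    apply le_antisymm
    · exact sInf_le ⟨k, ⟨h1, h2⟩, rfl⟩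
    · apply le_sInf
      rintro _ ⟨n, ⟨hn1, hn2⟩, rfl⟩
      by_contra hc
      have hc' : n < k := by
        have : (n : ℕ∞) < (k : ℕ∞) := not_le.mp hc
        exact_mod_cast this
      exact hn2 (h3 n hn1 hc')

theorem iter_mem_transit {M : Type*} (f g : M → M) (hgf : Function.LeftInverse g f)
    (hfg : Function.RightInverse g f) (A : Set M) (k m : ℕ) (hk : 1 ≤ k) (a : M) :
    g^[m] a ∈ transitComp f A (k + m) ↔
      a ∈ A ∧ exitTime f A a = (k : ℕ∞) ∧ exitTime g A a = ((m + 1 : ℕ) : ℕ∞) := by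
  have e0 : ∀ i x, f^[i] (g^[i] x) = x := fun i x => hfg.iterate i x
  have e1 : ∀ i, f^[i + m] (g^[m] a) = f^[i] a := fun i => by
    rw [Function.iterate_add_apply, e0]
  have e2 : ∀ i ≤ m, f^[i] (g^[m] a) = g^[m - i] a := fun i hi => by
    obtain ⟨j, rfl⟩ := Nat.exists_eq_add_of_le hi
    rw [Function.iterate_add_apply, e0, Nat.add_sub_cancel_left]
  have e3 : g^[m] a ∈ f '' A ↔ g^[m + 1] a ∈ A := by
    rw [Function.iterate_succ_apply']
    constructor
    · rintro ⟨x, hx, h⟩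
      rw [← h, hgf x]; exact hx
    · intro h
      exact ⟨_, h, hfg _⟩
  simp only [transitComp, entrySet, Set.mem_ofPred_eq, Set.mem_sdiff, exitTime_eq_coe, e3, e1]
  constructor
  · rintro ⟨⟨h1, h2⟩, h3, h4, h5⟩
    have h6 : ∀ i ≤ m, g^[i] a ∈ A := fun i hi => by
      by_cases h : i = m
      · rw [h]; exact h1
      · have := h5 (m - i) (by omega) (by omega)
        rwa [e2 _ (by omega), show m - (m - i) = i by omega] at this
    refine ⟨h6 0 (by omega), ⟨hk, h4, fun i hi hik => ?_⟩, by omega, h2, fun i _ hi => h6 i (by omega)⟩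
    have := h5 (i + m) (by omega) (by omega)
    rwa [e1] at this
  · rintro ⟨h0, ⟨_, h1, h2⟩, _, h3, h4⟩
    have h6 : ∀ i ≤ m, g^[i] a ∈ A := fun i hi => by
      by_cases h : i = 0
      · rw [h]; exact h0
      · exact h4 i (by omega) (by omega)
    refine ⟨⟨h6 m le_rfl, h3⟩, by omega, h1, fun i hi hik => ?_⟩
    by_cases h : i ≤ m
    · rw [e2 i h]; exact h6 _ (by omega)
    · obtain ⟨j, rfl⟩ := Nat.exists_eq_add_of_le (show m ≤ i by omega)
      rw [add_comm, e1]
      exact h2 j (by omega) (by omega)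

theorem measurableSet_transit {M : Type*} [MeasurableSpace M] (f g : M → M)
    (hgf : Function.LeftInverse g f) (hfg : Function.RightInverse g f)
    (hf : Measurable f) (hg : Measurable g) (A : Set M) (hA : MeasurableSet A) (j : ℕ) :
    MeasurableSet (transitComp f A j) := by
  have h : transitComp f A j = (A \ g ⁻¹' A) ∩
      ({_x : M | 1 ≤ j} ∩ ((f^[j] ⁻¹' A)ᶜ ∩
        ⋂ i : ℕ, ({_x : M | 1 ≤ i ∧ i < j}ᶜ ∪ f^[i] ⁻¹' A))) := by
    have : f '' A = g ⁻¹' A := congrFun (Set.image_eq_preimage_of_inverse hgf hfg) A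
    ext x
    simp only [transitComp, entrySet, this, exitTime_eq_coe, Set.mem_ofPred_eq, Set.mem_inter_iff,
      Set.mem_iInter, Set.mem_union, Set.mem_compl_iff, Set.mem_preimage]
    refine and_congr_right fun _ => and_congr_right fun _ => and_congr_right fun _ =>
      forall_congr' fun i => ?_
    tauto
  rw [h]
  refine (hA.diff (hg hA)).inter ((MeasurableSet.const _).inter
    (((hf.iterate j) hA).compl.inter (MeasurableSet.iInter fun i =>
      (MeasurableSet.const _).compl.union ((hf.iterate i) hA))))

/-- For every `k ≥ 1`, μ({a ∈ A_acc : t⁺(a) = k}) = Σ_{j=k}^∞ μ(T_j). -/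
theorem measure_accSet_exitTime_eq {M : Type*} [MeasurableSpace M] (μ : Measure M)
    (f g : M → M) (hgf : Function.LeftInverse g f) (hfg : Function.RightInverse g f)
    (hf : MeasurePreserving f μ μ) (hg : MeasurePreserving g μ μ)
    (A : Set M) (hA : MeasurableSet A) (hAfin : μ A ≠ ⊤) :
    ∀ k : ℕ, 1 ≤ k →
      μ {a ∈ accSet g A | exitTime f A a = (k : ℕ∞)}
        = ∑' j : ℕ, μ (transitComp f A (k + j)) := by
  intro k hk
  have hU : {a ∈ accSet g A | exitTime f A a = (k : ℕ∞)}
      = ⋃ m : ℕ, g^[m] ⁻¹' transitComp f A (k + m) := by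
    ext a
    simp only [Set.mem_iUnion, Set.mem_preimage, iter_mem_transit f g hgf hfg A _ _ hk,
      accSet, Set.mem_ofPred_eq]
    constructor
    · rintro ⟨⟨h1, h2⟩, h3⟩
      obtain ⟨n, hn⟩ := ENat.ne_top_iff_exists.mp h2
      have h4 := ((exitTime_eq_coe g A a n).mp hn.symm).1
      obtain ⟨m, rfl⟩ := Nat.exists_eq_add_of_le' h4
      exact ⟨m, h1, h3, hn.symm⟩
    · rintro ⟨m, h1, h2, h3⟩
      exact ⟨⟨h1, by rw [h3]; exact ENat.natCast_ne_top _⟩, h2⟩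
  have hT := measurableSet_transit f g hgf hfg hf.measurable hg.measurable A hA
  rw [hU, measure_iUnion]
  · exact tsum_congr fun m => (hg.iterate m).measure_preimage (hT _).nullMeasurableSet
  · intro m n hmn
    refine Set.disjoint_left.mpr fun a ha hb => hmn ?_
    have ha' := ((iter_mem_transit f g hgf hfg A _ _ hk a).mp ha).2.2
    have hb' := ((iter_mem_transit f g hgf hfg A _ _ hk a).mp hb).2.2
    rw [ha'] at hb'
    have : m + 1 = n + 1 := by exact_mod_cast hb'
    omega
  · exact fun m => (hg.iterate m).measurable (hT _)
end

section
/- For the Hénon area-preserving quadratic map H(x, y) = (y − k + x², −x) with k > −1 and x_s = 1 + √(1 + k), every bounded orbit is contained in the square of half-width x_s: if (zₙ)_{n ∈ ℤ} is a full orbit of H (i.e., z_{n+1} = H(zₙ) for all n ∈ ℤ) such that sup_{n ∈ ℤ} max(|xₙ|, |yₙ|) < ∞, then |xₙ| ≤ x_s and |yₙ| ≤ x_s for all n ∈ ℤ. -/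
/-- Every bounded full orbit of the Hénon map `H(x,y) = (y - k + x², -x)` (with
`k > -1`) is contained in the square of half-width `x_s = 1 + √(1 + k)`. -/
theorem henon_bounded_orbit_in_square (k : ℝ) (hk : -1 < k)
    (H : ℝ × ℝ → ℝ × ℝ) (hHdef : H = fun p => (p.2 - k + p.1 ^ 2, -p.1))
    (xs : ℝ) (hxs : xs = 1 + Real.sqrt (1 + k))
    (z : ℤ → ℝ × ℝ) (horbit : ∀ n : ℤ, z (n + 1) = H (z n))
    (hbdd : ∃ C : ℝ, ∀ n : ℤ, max |(z n).1| |(z n).2| ≤ C) :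
    ∀ n : ℤ, |(z n).1| ≤ xs ∧ |(z n).2| ≤ xs := by
  obtain ⟨C, hC⟩ := hbdd
  have h2 : ∀ n : ℤ, (z (n + 1)).2 = -(z n).1 := by
    intro n; rw [horbit, hHdef]
  have h1 : ∀ n : ℤ, (z (n + 1)).1 = (z n).2 - k + (z n).1 ^ 2 := by
    intro n; rw [horbit, hHdef]
  have h3 : ∀ n : ℤ, (z n).2 = -(z (n - 1)).1 := by
    intro n
    have := h2 (n - 1)
    rwa [sub_add_cancel] at this
  have hB : BddAbove (Set.range fun n : ℤ => |(z n).1|) := by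
    refine ⟨C, ?_⟩
    rintro _ ⟨n, rfl⟩
    exact (le_max_left _ _).trans (hC n)
  obtain ⟨S, hS⟩ : ∃ S, S = ⨆ n : ℤ, |(z n).1| := ⟨_, rfl⟩
  have hle : ∀ n : ℤ, |(z n).1| ≤ S := fun n => hS ▸ le_ciSup hB n
  have hsq : ∀ n : ℤ, (z n).1 ^ 2 ≤ k + 2 * S := by
    intro n
    have a := h1 n
    have b := h3 n
    have c := (le_abs_self _).trans (hle (n + 1))
    have d := (le_abs_self _).trans (hle (n - 1))
    linarith
  have hS0 : 0 ≤ S := (abs_nonneg _).trans (hle 0)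
  have hSs : S ≤ Real.sqrt (k + 2 * S) := by
    conv_lhs => rw [hS]
    exact ciSup_le fun n => Real.abs_le_sqrt (hsq n)
  have hpos : 0 ≤ k + 2 * S := (sq_nonneg _).trans (hsq 0)
  have hSS : S ^ 2 ≤ k + 2 * S := (Real.le_sqrt hS0 hpos).1 hSs
  have hfin : S ≤ xs := by
    have : S - 1 ≤ Real.sqrt (1 + k) := Real.le_sqrt_of_sq_le (by nlinarith)
    linarith
  intro n
  refine ⟨(hle n).trans hfin, ?_⟩
  rw [h3 n, abs_neg]
  exact (hle _).trans hfin
end
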